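/- In TL_2, the elements ρ(t^{-1/4}e_1 + t^{1/4}) and (t^{1/4}e_1 + t^{-1/4})ρ^{-1} are mutually inverse, and consequently there exists a unique unital ℂ-algebra homomorphism I_1 : TL_1 → TL_2 satisfying I_1(ρ) = ρ(t^{-1/4}e_1 + t^{1/4}) and I_1(ρ^{-1}) = (t^{1/4}e_1 + t^{-1/4})ρ^{-1}. -/

import Mathlib

/- Skein-theory paper, Statement 0.
`t4` plays the role of `t^{1/4}`; `t^{1/2} = t4^2`, `t = t4^4`.

The extended affine Temperley-Lieb algebra `TL t4 n` is defined by generators and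
relations via `RingQuot` of a relation on the free algebra:
generators `e i` (`i : ZMod n`, so that `e_n = e 0` and indices are taken mod `n`),
`r` (= ρ) and `ri` (= ρ⁻¹).  For `n = 2` the relations are
`eᵢ² = -(t^{1/2}+t^{-1/2})eᵢ`, `ρeᵢ = e_{i+1}ρ`, `ρρ⁻¹ = 1 = ρ⁻¹ρ`, `ρ²e₁ = e₁`;
for `n ≥ 3` they are the extended affine Temperley-Lieb relations.
`TL₁ = ℂ[ρ,ρ⁻¹]` is realised as `LaurentPolynomial ℂ` with `ρ = T 1`. -/

noncomputable section

namespace SkeinTL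

inductive TLgen (n : ℕ) : Type
  | e : ZMod n → TLgen n
  | r : TLgen n
  | ri : TLgen n

abbrev FA (n : ℕ) : Type := FreeAlgebra ℂ (TLgen n)

def ef (n : ℕ) (i : ZMod n) : FA n := FreeAlgebra.ι ℂ (TLgen.e i)
def rf (n : ℕ) : FA n := FreeAlgebra.ι ℂ TLgen.r
def rif (n : ℕ) : FA n := FreeAlgebra.ι ℂ TLgen.ri

/-- The defining relations of the extended affine Temperley-Lieb algebra.
For `n = 2` the presentation is the special one (`ρ²e₁ = e₁`), for `n ≥ 3` the
general one (indices mod `n`). -/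
inductive TLrel (t4 : ℂ) (n : ℕ) : FA n → FA n → Prop
  | esq (i : ZMod n) :
      TLrel t4 n (ef n i * ef n i) ((-(t4 ^ 2 + t4⁻¹ ^ 2)) • ef n i)
  | rer (i : ZMod n) :
      TLrel t4 n (rf n * ef n i) (ef n (i + 1) * rf n)
  | rri : TLrel t4 n (rf n * rif n) 1
  | rir : TLrel t4 n (rif n * rf n) 1
  | comm (h : 3 ≤ n) (i j : ZMod n) (h1 : i - j ≠ 1) (h2 : i - j ≠ -1) :
      TLrel t4 n (ef n i * ef n j) (ef n j * ef n i)
  | eplus (h : 3 ≤ n) (i : ZMod n) :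
      TLrel t4 n (ef n i * ef n (i + 1) * ef n i) (ef n i)
  | eminus (h : 3 ≤ n) (i : ZMod n) :
      TLrel t4 n (ef n i * ef n (i - 1) * ef n i) (ef n i)
  | cyc (h : 3 ≤ n) :
      TLrel t4 n ((rf n * ef n 1) ^ (n - 1)) (rf n ^ n * (rf n * ef n 1))
  | two (h : n = 2) :
      TLrel t4 n (rf n * rf n * ef n 1) (ef n 1)

/-- The extended affine Temperley-Lieb algebra `TL_n` (for `n ≥ 2`). -/
abbrev TL (t4 : ℂ) (n : ℕ) : Type := RingQuot (TLrel t4 n)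

/-- The generator `e_i` of `TL_n` (index mod `n`). -/
def E (t4 : ℂ) (n : ℕ) (i : ZMod n) : TL t4 n :=
  RingQuot.mkAlgHom ℂ (TLrel t4 n) (ef n i)

/-- The generator `ρ` of `TL_n`. -/
def R (t4 : ℂ) (n : ℕ) : TL t4 n :=
  RingQuot.mkAlgHom ℂ (TLrel t4 n) (rf n)

/-- The generator `ρ⁻¹` of `TL_n`. -/
def Ri (t4 : ℂ) (n : ℕ) : TL t4 n :=
  RingQuot.mkAlgHom ℂ (TLrel t4 n) (rif n)

/-- The scalar `c` viewed in `TL_n`. -/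
def Ct (t4 : ℂ) (n : ℕ) (c : ℂ) : TL t4 n := algebraMap ℂ (TL t4 n) c

/-- If `e * e = -(a ^ 2 + a⁻¹ ^ 2) • e`, then `a⁻¹ • e + a` is left inverse to `a • e + a⁻¹`. -/
theorem smul_add_algebraMap_mul_eq_one {K A : Type*} [Field K] [Semiring A] [Algebra K A]
    {a : K} (ha : a ≠ 0) {e : A} (he : e * e = (-(a ^ 2 + a⁻¹ ^ 2)) • e) :
    (a⁻¹ • e + algebraMap K A a) * (a • e + algebraMap K A a⁻¹) = 1 := by
  simp only [Algebra.algebraMap_eq_smul_one, add_mul, mul_add, smul_mul_smul_comm, he, mul_one,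
    one_mul, inv_mul_cancel₀ ha, mul_inv_cancel₀ ha, one_smul]
  rw [← add_assoc, ← add_smul, ← add_smul,
    show -(a ^ 2 + a⁻¹ ^ 2) + a * a + a⁻¹ * a⁻¹ = 0 by ring, zero_smul, zero_add]

theorem E_mul_self (t4 : ℂ) (n : ℕ) (i : ZMod n) :
    E t4 n i * E t4 n i = (-(t4 ^ 2 + t4⁻¹ ^ 2)) • E t4 n i := by
  simpa only [map_mul, map_smul] using! RingQuot.mkAlgHom_rel ℂ (TLrel.esq (t4 := t4) i)

theorem R_mul_Ri (t4 : ℂ) (n : ℕ) : R t4 n * Ri t4 n = 1 := by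
  simpa only [map_mul, map_one] using!
    RingQuot.mkAlgHom_rel ℂ (TLrel.rri (t4 := t4) (n := n))

theorem Ri_mul_R (t4 : ℂ) (n : ℕ) : Ri t4 n * R t4 n = 1 := by
  simpa only [map_mul, map_one] using!
    RingQuot.mkAlgHom_rel ℂ (TLrel.rir (t4 := t4) (n := n))

/-- A unit `u` of an algebra extends uniquely to a homomorphism from Laurent polynomials sending
`T 1` to `u` and `T (-1)` to `u⁻¹`. -/
theorem existsUnique_laurentPolynomial_algHom {K A : Type*} [CommSemiring K] [Semiring A]
    [Algebra K A] (u : Aˣ) :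
    ∃! I : LaurentPolynomial K →ₐ[K] A,
      I (LaurentPolynomial.T 1) = u ∧ I (LaurentPolynomial.T (-1)) = ↑u⁻¹ := by
  refine ⟨AddMonoidAlgebra.lift K A ℤ ((Units.coeHom A).comp (zpowersHom Aˣ u)), ⟨?_, ?_⟩, ?_⟩
  · simp [LaurentPolynomial.T, -LaurentPolynomial.single_eq_C_mul_T]
  · simp [LaurentPolynomial.T, -LaurentPolynomial.single_eq_C_mul_T]
  · rintro J ⟨hJ, -⟩
    refine AddMonoidAlgebra.algHom_ext' (MonoidHom.ext_mint ?_) (Subsingleton.elim _ _)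
    simpa [LaurentPolynomial.T, -LaurentPolynomial.single_eq_C_mul_T] using hJ

/-- In `TL₂`, the elements `ρ(t^{-1/4}e₁ + t^{1/4})` and
`(t^{1/4}e₁ + t^{-1/4})ρ⁻¹` are mutually inverse, and consequently there is a unique
unital ℂ-algebra homomorphism `I₁ : TL₁ → TL₂` with `I₁(ρ) = ρ(t^{-1/4}e₁ + t^{1/4})`
and `I₁(ρ⁻¹) = (t^{1/4}e₁ + t^{-1/4})ρ⁻¹`. -/
theorem statement0 (t4 : ℂ) (ht4 : t4 ≠ 0) :
    (R t4 2 * (t4⁻¹ • E t4 2 1 + Ct t4 2 t4)) *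
        ((t4 • E t4 2 1 + Ct t4 2 t4⁻¹) * Ri t4 2) = 1 ∧
    ((t4 • E t4 2 1 + Ct t4 2 t4⁻¹) * Ri t4 2) *
        (R t4 2 * (t4⁻¹ • E t4 2 1 + Ct t4 2 t4)) = 1 ∧
    ∃! I : LaurentPolynomial ℂ →ₐ[ℂ] TL t4 2,
      I (LaurentPolynomial.T 1) = R t4 2 * (t4⁻¹ • E t4 2 1 + Ct t4 2 t4) ∧
      I (LaurentPolynomial.T (-1)) = (t4 • E t4 2 1 + Ct t4 2 t4⁻¹) * Ri t4 2 := by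
  have h_left := smul_add_algebraMap_mul_eq_one ht4 (E_mul_self t4 2 1)
  have h_right := smul_add_algebraMap_mul_eq_one (inv_ne_zero ht4) (e := E t4 2 1)
    (by rw [inv_inv, add_comm]; exact E_mul_self t4 2 1)
  rw [inv_inv] at h_right
  let v : (TL t4 2)ˣ := ⟨_, _, h_left, h_right⟩
  let u : (TL t4 2)ˣ := ⟨R t4 2, Ri t4 2, R_mul_Ri t4 2, Ri_mul_R t4 2⟩
  exact ⟨(u * v).mul_inv, (u * v).inv_mul, existsUnique_laurentPolynomial_algHom (u * v)⟩

end SkeinTL
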